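/- Let G be a toroidal grid diagram of size n representing a knot K. Then the Maslov grading of the canonical generator x^UR is given by M(x^UR) = −writhe(K) − #{downward cusps of G} + 1. -/

import Mathlib

open Finset

noncomputable section

open scoped Classical

/-- A formal rational-coefficient combination of points in the plane. -/
abbrev PtComb := (ℝ × ℝ) →₀ ℚ

/-- `I(A,B)`: the number of pairs `(a, b) ∈ A × B` with `a₁ < b₁` and `a₂ < b₂`,
extended bilinearly to formal combinations of finite point sets. -/
def Ifun (f g : PtComb) : ℚ :=
  ∑ p ∈ f.support, ∑ q ∈ g.support,
    if p.1 < q.1 ∧ p.2 < q.2 then f p * g q else 0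

/-- `J(A,B) = (I(A,B) + I(B,A))/2`. -/
def Jfun (f g : PtComb) : ℚ := (Ifun f g + Ifun g f) / 2

/-- A toroidal grid diagram of size `n`: a pair of permutations `σX`, `σO` of
`{0, …, n-1}` with `σX i ≠ σO i` for all `i`. -/
structure Grid (n : ℕ) where
  σX : Equiv.Perm (Fin n)
  σO : Equiv.Perm (Fin n)
  disj : ∀ i, σX i ≠ σO i

namespace Grid

variable {n : ℕ}

/-- `G` represents a knot: the permutation `σO⁻¹ ∘ σX` has a single orbit,
i.e. it is an `n`-cycle. -/
def RepKnot (G : Grid n) : Prop :=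
  ∀ i j : Fin n, ∃ k : ℕ, ((G.σO⁻¹ * G.σX) ^ k) i = j

/-- The `X`-marking of column `i`, at the planar point `(i + 1/2, σX i + 1/2)`. -/
def Xpt (G : Grid n) (i : Fin n) : ℝ × ℝ :=
  (((i : ℕ) : ℝ) + 1/2, ((G.σX i : ℕ) : ℝ) + 1/2)

/-- The `O`-marking of column `i`, at the planar point `(i + 1/2, σO i + 1/2)`. -/
def Opt (G : Grid n) (i : Fin n) : ℝ × ℝ :=
  (((i : ℕ) : ℝ) + 1/2, ((G.σO i : ℕ) : ℝ) + 1/2)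

/-- The set `𝕏` of `X`-markings, as a formal point combination. -/
def XX (G : Grid n) : PtComb := ∑ i : Fin n, Finsupp.single (G.Xpt i) 1

/-- The set `𝕆` of `O`-markings, as a formal point combination. -/
def OO (G : Grid n) : PtComb := ∑ i : Fin n, Finsupp.single (G.Opt i) 1

/-- The point set `{(i, x i)}` of a generator `x`, as a formal point combination. -/
def pts (x : Equiv.Perm (Fin n)) : PtComb :=
  ∑ i : Fin n, Finsupp.single (((i : ℕ) : ℝ), ((x i : ℕ) : ℝ)) 1

/-- The Maslov grading `M(x) = J(x − 𝕆, x − 𝕆) + 1`. -/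
def M (G : Grid n) (x : Equiv.Perm (Fin n)) : ℚ :=
  Jfun (pts x - G.OO) (pts x - G.OO) + 1

/-- The `X`-Maslov grading `M_𝕏(x) = J(x − 𝕏, x − 𝕏) + 1`. -/
def MX (G : Grid n) (x : Equiv.Perm (Fin n)) : ℚ :=
  Jfun (pts x - G.XX) (pts x - G.XX) + 1

/-- The Alexander grading `A(x) = J(x − (𝕏+𝕆)/2, 𝕏 − 𝕆) − (n−1)/2`. -/
def A (G : Grid n) (x : Equiv.Perm (Fin n)) : ℚ :=
  Jfun (pts x - (2 : ℚ)⁻¹ • (G.XX + G.OO)) (G.XX - G.OO) - ((n : ℚ) - 1) / 2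

/-- The canonical generator `x^LL`, whose points are the lower-left corners of the
`X`-marked squares. -/
def xLL (G : Grid n) : Equiv.Perm (Fin n) := G.σX

/-- The canonical generator `x^UR`, `x^UR(i) = σX((i−1) mod n) + 1 (mod n)`, whose points
are the upper-right corners of the `X`-marked squares (reduced mod `n`). -/
def xUR [NeZero n] (G : Grid n) : Equiv.Perm (Fin n) where
  toFun i := G.σX (i - 1) + 1
  invFun i := G.σX.symm (i - 1) + 1
  left_inv i := by simp
  right_inv i := by simp

end Grid

namespace Grid

variable {n : ℕ}

/-- The vertical segment of column `i` (from `X_i` to `O_i`) and the horizontal segment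
of row `j` (from the `O` of row `j` to the `X` of row `j`) cross transversally in the
interiors of both segments. -/
def Crossing (G : Grid n) (i j : Fin n) : Prop :=
  min (G.σX i) (G.σO i) < j ∧ j < max (G.σX i) (G.σO i) ∧
  min (G.σX.symm j) (G.σO.symm j) < i ∧ i < max (G.σX.symm j) (G.σO.symm j)

/-- The sign of the crossing of the vertical segment of column `i` with the horizontal
segment of row `j`: it is `+1` iff `det(v, h) > 0`, where `v` points from `X_i` to `O_i`
and `h` points from the `O`-marking of row `j` to its `X`-marking. -/
def crossSign (G : Grid n) (i j : Fin n) : ℤ :=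
  if ((G.σX i < G.σO i) ↔ (G.σO.symm j < G.σX.symm j)) then -1 else 1

/-- The writhe of the planar diagram `D(G)`: the sum of the signs of all crossings. -/
def writhe (G : Grid n) : ℤ :=
  ∑ p : Fin n × Fin n, if G.Crossing p.1 p.2 then G.crossSign p.1 p.2 else 0

/-- `X_i` is a NE corner: the `O`-marking of its row lies strictly to its left, and
`σO i < σX i`. -/
def XNE (G : Grid n) (i : Fin n) : Prop :=
  G.σO.symm (G.σX i) < i ∧ G.σO i < G.σX i

/-- `X_i` is a SW corner: the `O`-marking of its row lies strictly to its right, and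
`σO i > σX i`. -/
def XSW (G : Grid n) (i : Fin n) : Prop :=
  i < G.σO.symm (G.σX i) ∧ G.σX i < G.σO i

/-- `O_i` is a NE corner: the `X`-marking of its row lies strictly to its left, and
`σX i < σO i`. -/
def ONE (G : Grid n) (i : Fin n) : Prop :=
  G.σX.symm (G.σO i) < i ∧ G.σX i < G.σO i

/-- `O_i` is a SW corner: the `X`-marking of its row lies strictly to its right, and
`σX i > σO i`. -/
def OSW (G : Grid n) (i : Fin n) : Prop :=
  i < G.σX.symm (G.σO i) ∧ G.σO i < G.σX i

/-- The number of downward-oriented cusps: `X`-markings that are NE corners together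
with `O`-markings that are SW corners. -/
def downCusps (G : Grid n) : ℕ :=
  (univ.filter fun i => G.XNE i).card + (univ.filter fun i => G.OSW i).card

/-- The number of upward-oriented cusps: `O`-markings that are NE corners together
with `X`-markings that are SW corners. -/
def upCusps (G : Grid n) : ℕ :=
  (univ.filter fun i => G.ONE i).card + (univ.filter fun i => G.XSW i).card

/-- The total number of cusps (markings that are NE or SW corners). -/
def cusps (G : Grid n) : ℕ := G.downCusps + G.upCusps

/-- The Thurston–Bennequin invariant of the Legendrian knot associated to `G`:
`tb = −writhe − (1/2)·#cusps`. -/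
def tb (G : Grid n) : ℚ := -(G.writhe : ℚ) - (G.cusps : ℚ) / 2

/-- The rotation number of the oriented Legendrian knot associated to `G`:
`r = (1/2)·(#downward cusps − #upward cusps)`. -/
def rot (G : Grid n) : ℚ := ((G.downCusps : ℚ) - (G.upCusps : ℚ)) / 2

end Grid

namespace MaslovProof

/-- The kernel of the bilinear form `Ifun`. -/
def ker (p q : ℝ × ℝ) : ℚ := if p.1 < q.1 ∧ p.2 < q.2 then 1 else 0

/-- strict indicator -/
def lt' {n : ℕ} (p q : Fin n) : ℚ := if p < q then 1 else 0

/-- weak indicator -/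
def le' {n : ℕ} (p q : Fin n) : ℚ := if p ≤ q then 1 else 0

/-- indicator of the last index -/
def last' {n : ℕ} (p : Fin n) : ℚ := if (p : ℕ) + 1 = n then 1 else 0

lemma Ifun_eq (f g : PtComb) :
    Ifun f g = Finsupp.linearCombination ℚ
      (fun p => Finsupp.linearCombination ℚ (fun q => ker p q) g) f := by
  simp only [Finsupp.linearCombination_apply, Finsupp.sum, Ifun, ker, smul_eq_mul,
    Finset.mul_sum]
  refine Finset.sum_congr rfl fun p _ => Finset.sum_congr rfl fun q _ => ?_
  split_ifs <;> simp

lemma M_eq {n : ℕ} (G : Grid n) (x : Equiv.Perm (Fin n)) :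
    G.M x = (∑ i, ∑ j, (lt' i j * lt' (x i) (x j) - le' i j * le' (x i) (G.σO j)
      - lt' i j * lt' (G.σO i) (x j) + lt' i j * lt' (G.σO i) (G.σO j))) + 1 := by
  have k1 : ∀ i j, ker (((i : Fin n) : ℕ), ((x i : ℕ) : ℝ)) (((j : Fin n) : ℕ), ((x j : ℕ) : ℝ))
      = lt' i j * lt' (x i) (x j) := by
    intro i j
    simp only [ker, lt', Nat.cast_lt, Fin.lt_def, ite_and]
    split_ifs <;> simp
  have half : ∀ a b : ℕ, ((a : ℝ) < b + 1/2) ↔ a ≤ b := by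
    intro a b
    constructor
    · intro h
      by_contra! h'
      have : (b : ℝ) + 1 ≤ a := by exact_mod_cast h'
      linarith
    · intro h
      have : (a : ℝ) ≤ b := by exact_mod_cast h
      linarith
  have half' : ∀ a b : ℕ, ((a : ℝ) + 1/2 < b) ↔ a < b := by
    intro a b
    constructor
    · intro h
      have : (a : ℝ) < b := by linarith
      exact_mod_cast this
    · intro h
      have : (a : ℝ) + 1 ≤ b := by exact_mod_cast h
      linarith
  have k2 : ∀ i j, ker (((i : Fin n) : ℕ), ((x i : ℕ) : ℝ)) (G.Opt j)
      = le' i j * le' (x i) (G.σO j) := by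
    intro i j
    simp only [ker, le', Grid.Opt, half, Fin.le_def, ite_and]
    split_ifs <;> simp
  have k3 : ∀ i j, ker (G.Opt i) (((j : Fin n) : ℕ), ((x j : ℕ) : ℝ))
      = lt' i j * lt' (G.σO i) (x j) := by
    intro i j
    simp only [ker, lt', Grid.Opt, half', Fin.lt_def, ite_and]
    split_ifs <;> simp
  have k4 : ∀ i j, ker (G.Opt i) (G.Opt j)
      = lt' i j * lt' (G.σO i) (G.σO j) := by
    intro i j
    simp only [ker, lt', Grid.Opt, Fin.lt_def, ite_and, add_lt_add_iff_right, Nat.cast_lt]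
    split_ifs <;> simp
  have hJ : ∀ f, Jfun f f = Ifun f f := by intro f; simp [Jfun]
  rw [Grid.M, hJ, Ifun_eq]
  simp only [map_sub, map_sum, Grid.pts, Grid.OO, Finsupp.linearCombination_single, one_smul,
    k1, k2, k3, k4, Finset.sum_sub_distrib, Finset.sum_add_distrib]
  ring

lemma succ_val {n : ℕ} [NeZero n] (hn : 2 ≤ n) (k : Fin n) :
    ((k + 1 : Fin n) : ℕ) = if (k : ℕ) + 1 = n then 0 else (k : ℕ) + 1 := by
  have h1 : ((1 : Fin n) : ℕ) = 1 := by
    rw [Fin.val_one']; exact Nat.mod_eq_of_lt hn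
  rw [Fin.val_add, h1]
  split_ifs with h
  · rw [h, Nat.mod_self]
  · exact Nat.mod_eq_of_lt (by omega)

lemma lt_succ_succ {n : ℕ} [NeZero n] (hn : 2 ≤ n) (k l : Fin n) :
    lt' (k + 1) (l + 1) = lt' k l + last' k - last' l := by
  have := k.2
  have := l.2
  simp only [lt', last', Fin.lt_def, succ_val hn]
  split_ifs <;> first | omega | norm_num

lemma le_succ_left {n : ℕ} [NeZero n] (hn : 2 ≤ n) (k l : Fin n) :
    le' (k + 1) l = lt' k l + last' k := by
  have := k.2
  have := l.2
  simp only [lt', le', last', Fin.lt_def, Fin.le_def, succ_val hn]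
  split_ifs <;> first | omega | norm_num

lemma lt_succ_right {n : ℕ} [NeZero n] (hn : 2 ≤ n) (k l : Fin n) :
    lt' k (l + 1) = le' k l - last' l := by
  have := k.2
  have := l.2
  simp only [lt', le', last', Fin.lt_def, Fin.le_def, succ_val hn]
  split_ifs <;> first | omega | norm_num

lemma le_eq {n : ℕ} (k l : Fin n) : le' k l = lt' k l + if k = l then 1 else 0 := by
  simp only [lt', le', Fin.lt_def, Fin.le_def, Fin.ext_iff]
  split_ifs <;> first | omega | norm_num

lemma sum_last {n : ℕ} [NeZero n] : ∑ k : Fin n, last' k = 1 := by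
  have h : 0 < n := Nat.pos_of_ne_zero (NeZero.ne n)
  rw [Finset.sum_eq_single (⟨n - 1, by omega⟩ : Fin n)]
  · simp [last']; omega
  · intro b _ hb
    have : ¬ ((b : ℕ) + 1 = n) := fun h' => hb (Fin.ext (by simp; omega))
    simp [last', this]
  · simp

/-- reindexing `O` by `X` -/
lemma sum_reindex {n : ℕ} (G : Grid n) (f : Fin n → ℚ) :
    ∑ j, f (G.σO j) = ∑ j, f (G.σX j) := by
  rw [Equiv.sum_comp G.σO f, Equiv.sum_comp G.σX f]

lemma step1 {n : ℕ} [NeZero n] (hn : 2 ≤ n) (G : Grid n) :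
    G.M G.xUR = (∑ i, ∑ j, (lt' i j * lt' (G.σX i) (G.σX j) - lt' i j * lt' (G.σX i) (G.σO j)
      - le' i j * le' (G.σO i) (G.σX j) + lt' i j * lt' (G.σO i) (G.σO j))) + 1 := by
  have hx : ∀ k, G.xUR (k + 1) = G.σX k + 1 := by intro k; simp [Grid.xUR]
  have sh : ∀ f : Fin n → ℚ, ∑ i, f i = ∑ i, f (i + 1) := fun f =>
    (Equiv.sum_comp (Equiv.addRight (1 : Fin n)) f).symm
  rw [M_eq]
  congr 1
  simp only [Finset.sum_sub_distrib, Finset.sum_add_distrib]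
  rw [sh fun i => ∑ j, lt' i j * lt' (G.xUR i) (G.xUR j),
    sh fun i => ∑ j, le' i j * le' (G.xUR i) (G.σO j)]
  simp_rw [sh fun j => lt' _ j * lt' (G.xUR _) (G.xUR j),
    sh fun j => lt' _ j * lt' (G.σO _) (G.xUR j)]
  simp only [hx, lt_succ_succ hn, le_succ_left hn, lt_succ_right hn]
  have e1 : ∑ i, ∑ j, last' i * lt' (G.σX i) (G.σO j)
      = ∑ i, ∑ j, last' i * lt' (G.σX i) (G.σX j) :=
    Finset.sum_congr rfl fun i _ => sum_reindex G fun y => last' i * lt' (G.σX i) y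
  have e2 : ∑ i, ∑ j, last' j * le' (G.σO i) (G.σX j)
      = ∑ i, ∑ j, last' i * le' (G.σX j) (G.σX i) := by
    rw [Finset.sum_comm]
    exact Finset.sum_congr rfl fun i _ => sum_reindex G fun y => last' i * le' y (G.σX i)
  have e3 : ∑ i, ∑ j, le' i j * last' (G.σX j) = ∑ i, ∑ j, le' j i * last' (G.σX i) :=
    Finset.sum_comm
  have e4 : ∑ i, ∑ j, lt' i j * last' (G.σX j) = ∑ i, ∑ j, lt' j i * last' (G.σX i) :=
    Finset.sum_comm
  have e5 : ∑ i, ∑ j, last' j * lt' (G.σX i) (G.σX j)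
      = ∑ i, ∑ j, last' i * lt' (G.σX j) (G.σX i) := Finset.sum_comm
  have e6 : ∑ i, ∑ j, last' j * last' (G.σX j) = ∑ i, ∑ j : Fin n, last' i * last' (G.σX i) :=
    Finset.sum_comm
  have sX : ∑ k, last' (G.σX k) = 1 := by
    rw [Equiv.sum_comp G.σX last', sum_last]
  have e7 : ∑ i : Fin n, ∑ j : Fin n, last' i * last' (G.σX j) = 1 := by
    rw [← Finset.sum_mul_sum, sum_last, sX, one_mul]
  have e8 : ∑ i : Fin n, ∑ j : Fin n, last' j * last' (G.σX i) = 1 := by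
    rw [Finset.sum_comm, e7]
  have e9 : ∑ i, ∑ j, le' j i * last' (G.σX i)
      = ∑ i, ∑ j, lt' j i * last' (G.σX i) + 1 := by
    simp only [le_eq, add_mul, Finset.sum_add_distrib, ite_mul, one_mul, zero_mul,
      Finset.sum_ite_eq', Finset.mem_univ, if_true, sX]
  have e10 : ∑ i, ∑ j, last' i * le' (G.σX j) (G.σX i)
      = ∑ i, ∑ j, last' i * lt' (G.σX j) (G.σX i) + 1 := by
    simp only [le_eq, mul_add, Finset.sum_add_distrib, mul_ite, mul_one, mul_zero,
      EmbeddingLike.apply_eq_iff_eq,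
      Finset.sum_ite_eq', Finset.mem_univ, if_true, sum_last]
  simp only [add_mul, sub_mul, mul_add, mul_sub, Finset.sum_sub_distrib, Finset.sum_add_distrib]
  rw [e1, e2, e3, e4, e5, e6, e7, e8, e9, e10]
  ring

lemma step2 {n : ℕ} (G : Grid n) :
    ∑ i, ∑ j, le' i j * le' (G.σO i) (G.σX j) =
      ∑ i, ∑ j, lt' i j * lt' (G.σO i) (G.σX j) + ∑ i, lt' (G.σO i) (G.σX i)
        + ∑ j, lt' (G.σO.symm (G.σX j)) j := by
  have p : ∀ i j, le' i j * le' (G.σO i) (G.σX j) = lt' i j * lt' (G.σO i) (G.σX j)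
      + (if i = j then lt' (G.σO i) (G.σX j) else 0)
      + (if i = G.σO.symm (G.σX j) then lt' i j else 0) := by
    intro i j
    have h1 : (i = G.σO.symm (G.σX j)) ↔ G.σO i = G.σX j := by
      rw [Equiv.eq_symm_apply]
    rw [le_eq, le_eq]
    by_cases hij : i = j
    · subst hij
      have := (G.disj i).symm
      simp [h1, this]
      ring
    · simp only [h1, hij, if_false]
      split_ifs <;> ring
  simp only [p, Finset.sum_add_distrib]
  congr 1
  · simp
  · rw [Finset.sum_comm]; simp

lemma point_aux {n : ℕ} (i j a b c d : Fin n) (h1 : c ≠ j) (h2 : d ≠ j) (h3 : a ≠ i) (h4 : b ≠ i)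
    (P : Prop) (hP : P ↔ min c d < j ∧ j < max c d ∧ min a b < i ∧ i < max a b) :
    (((if c < j then 1 else 0) - if d < j then 1 else 0) *
        ((if i < a then 1 else 0) - if i < b then 1 else 0) : ℚ) =
      -((if P then
            if c < d ↔ b < a then -1 else 1
          else 0 : ℤ) : ℚ) := by
  simp only [min_lt_iff, lt_max_iff, Fin.lt_def, ne_eq, Fin.ext_iff] at *
  by_cases p : P
  · have p' := hP.1 p
    rw [if_pos p]
    clear hP
    split_ifs <;> first | omega | norm_num
  · have p' := mt hP.2 p
    rw [if_neg p]
    clear hP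
    split_ifs <;> first | omega | norm_num

/-- Pointwise comparison. -/
lemma point {n : ℕ} (G : Grid n) (i j : Fin n) :
    (lt' (G.σX i) j - lt' (G.σO i) j) * (lt' i (G.σX.symm j) - lt' i (G.σO.symm j)) =
      -((if G.Crossing i j then G.crossSign i j else 0 : ℤ) : ℚ)
      + (if j = G.σX i then lt' (G.σO i) (G.σX i) * lt' i (G.σO.symm (G.σX i)) else 0)
      + (if j = G.σO i then lt' (G.σX i) (G.σO i) * lt' i (G.σX.symm (G.σO i)) else 0) := by
  have hd := G.disj i
  by_cases h1 : j = G.σX i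
  · subst h1
    have hc : ¬ G.Crossing i (G.σX i) := by
      rintro ⟨h, h', -, -⟩
      simp only [min_lt_iff, lt_max_iff, lt_irrefl, false_or] at h h'
      exact lt_asymm h h'
    simp only [hc, hd, lt', if_true, if_false, Equiv.symm_apply_apply, lt_irrefl]
    split_ifs <;> simp
  by_cases h2 : j = G.σO i
  · subst h2
    have hc : ¬ G.Crossing i (G.σO i) := by
      rintro ⟨h, h', -, -⟩
      simp only [min_lt_iff, lt_max_iff, lt_irrefl, or_false] at h h'
      exact lt_asymm h h'
    simp only [hc, h1, lt', if_true, if_false, Equiv.symm_apply_apply, lt_irrefl]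
    split_ifs <;> simp
  have h3 : G.σX.symm j ≠ i := fun h => h1 (by rw [← h]; simp)
  have h4 : G.σO.symm j ≠ i := fun h => h2 (by rw [← h]; simp)
  simp only [h1, h2, if_false, Grid.crossSign, lt', add_zero]
  exact point_aux i j _ _ _ _ (Ne.symm h1) (Ne.symm h2) h3 h4 (G.Crossing i j) Iff.rfl

lemma step3 {n : ℕ} (G : Grid n) :
    ∑ i, ∑ j, (lt' i j * lt' (G.σX i) (G.σX j) - lt' i j * lt' (G.σX i) (G.σO j)
      - lt' i j * lt' (G.σO i) (G.σX j) + lt' i j * lt' (G.σO i) (G.σO j)) =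
    -(G.writhe : ℚ) + ∑ i, lt' (G.σO i) (G.σX i) * lt' i (G.σO.symm (G.σX i))
      + ∑ i, lt' (G.σX i) (G.σO i) * lt' i (G.σX.symm (G.σO i)) := by
  have hw : (G.writhe : ℚ) = ∑ i, ∑ j,
      ((if G.Crossing i j then G.crossSign i j else 0 : ℤ) : ℚ) := by
    rw [Grid.writhe, Fintype.sum_prod_type]
    push_cast
    rfl
  have hs := Finset.sum_congr (rfl : (univ : Finset (Fin n)) = univ) fun i _ =>
    Finset.sum_congr (rfl : (univ : Finset (Fin n)) = univ) fun j _ => point G i j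
  simp only [Finset.sum_add_distrib, Finset.sum_neg_distrib, ← hw, Finset.sum_ite_eq',
    Finset.mem_univ, if_true] at hs
  rw [← hs]
  refine Finset.sum_congr rfl fun i _ => ?_
  have a1 := Equiv.sum_comp G.σX fun j => (lt' (G.σX i) j - lt' (G.σO i) j) * lt' i (G.σX.symm j)
  have a2 := Equiv.sum_comp G.σO fun j => (lt' (G.σX i) j - lt' (G.σO i) j) * lt' i (G.σO.symm j)
  simp only [mul_sub, Finset.sum_sub_distrib (s := univ) (f := fun j =>
    (lt' (G.σX i) j - lt' (G.σO i) j) * lt' i (G.σX.symm j)), ← a1, ← a2,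
    Equiv.symm_apply_apply, ← Finset.sum_sub_distrib]
  refine Finset.sum_congr rfl fun j _ => ?_
  ring

lemma lt_compl {n : ℕ} {p q : Fin n} (h : p ≠ q) : lt' p q = 1 - lt' q p := by
  simp only [lt', Fin.lt_def, ne_eq, Fin.ext_iff] at *
  split_ifs <;> first | omega | norm_num

lemma step4 {n : ℕ} (G : Grid n) : (G.downCusps : ℚ) =
    ∑ i, lt' (G.σO.symm (G.σX i)) i * lt' (G.σO i) (G.σX i)
    + ∑ i, lt' i (G.σX.symm (G.σO i)) * lt' (G.σO i) (G.σX i) := by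
  have h : ∀ (R P Q : Fin n → Prop), (∀ i, R i ↔ P i ∧ Q i) →
      ((univ.filter fun i => R i).card : ℚ)
      = ∑ i, (if P i then 1 else 0) * (if Q i then 1 else 0) := by
    intro R P Q hR
    rw [Finset.card_filter, Nat.cast_sum]
    refine Finset.sum_congr rfl fun i _ => ?_
    by_cases hP : P i <;> by_cases hQ : Q i <;> simp [hP, hQ, hR]
  have h1 := h G.XNE (fun i => G.σO.symm (G.σX i) < i) (fun i => G.σO i < G.σX i)
    fun _ => Iff.rfl
  have h2 := h G.OSW (fun i => i < G.σX.symm (G.σO i)) (fun i => G.σO i < G.σX i)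
    fun _ => Iff.rfl
  rw [Grid.downCusps, Nat.cast_add, h1, h2]
  refine congrArg₂ (· + ·) ?_ ?_ <;> refine Finset.sum_congr rfl fun i _ => ?_ <;>
    simp only [lt'] <;> split_ifs <;> rfl

lemma final {n : ℕ} [NeZero n] (hn : 2 ≤ n) (G : Grid n) :
    G.M G.xUR = -(G.writhe : ℚ) - (G.downCusps : ℚ) + 1 := by
  have h1 := step1 hn G
  have h2 := step2 G
  have h3 := step3 G
  rw [step4, h1]
  simp only [Finset.sum_sub_distrib, Finset.sum_add_distrib] at h3 ⊢
  rw [h2]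
  -- the number of `O` lying west of the `X` of their row
  have h5 : ∑ i, lt' i (G.σX.symm (G.σO i)) = ∑ i, lt' (G.σO.symm (G.σX i)) i := by
    have a1 := Equiv.sum_comp G.σO fun j => lt' (G.σO.symm j) (G.σX.symm j)
    have a2 := Equiv.sum_comp G.σX fun j => lt' (G.σO.symm j) (G.σX.symm j)
    simp only [Equiv.symm_apply_apply] at a1 a2
    rw [a1, a2]
  have h6 : ∑ i, lt' (G.σO i) (G.σX i) * lt' i (G.σO.symm (G.σX i))
      = ∑ i, lt' (G.σO i) (G.σX i)
        - ∑ i, lt' (G.σO.symm (G.σX i)) i * lt' (G.σO i) (G.σX i) := by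
    rw [← Finset.sum_sub_distrib]
    refine Finset.sum_congr rfl fun i _ => ?_
    have : i ≠ G.σO.symm (G.σX i) := by
      intro h
      rw [Equiv.eq_symm_apply] at h
      exact G.disj i h.symm
    rw [lt_compl this]; ring
  have h7 : ∑ i, lt' (G.σX i) (G.σO i) * lt' i (G.σX.symm (G.σO i))
      = ∑ i, lt' i (G.σX.symm (G.σO i))
        - ∑ i, lt' i (G.σX.symm (G.σO i)) * lt' (G.σO i) (G.σX i) := by
    rw [← Finset.sum_sub_distrib]
    refine Finset.sum_congr rfl fun i _ => ?_
    rw [lt_compl (G.disj i)]; ring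
  linarith

end MaslovProof

/-- For a toroidal grid diagram `G` of size `n` representing a knot `K`,
the Maslov grading of the canonical generator `x^UR` is
`M(x^UR) = −writhe(K) − #{downward cusps of G} + 1`. -/
theorem maslov_xUR {n : ℕ} [NeZero n] (hn : 2 ≤ n) (G : Grid n) (hK : G.RepKnot) :
    G.M G.xUR = -(G.writhe : ℚ) - (G.downCusps : ℚ) + 1 := by
  exact MaslovProof.final hn G
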